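/- Let B ∈ ℝ^{d×d} be a symmetric matrix such that B̂ = H_*^{-1/2} B H_*^{-1/2} is invertible, let x ∈ ℝ^d, and let x⁺ = x − B^{-1}∇f(x). Setting σ = (M/μ^{3/2})‖H_*^{1/2}(x − x_*)‖ and σ⁺ = (M/μ^{3/2})‖H_*^{1/2}(x⁺ − x_*)‖, one has σ⁺ ≤ ‖B̂^{-1}‖·(σ + ‖B̂ − I‖)·σ. -/

import Mathlib

noncomputable section

open Matrix Finset

abbrev E (d : ℕ) := EuclideanSpace ℝ (Fin d)
abbrev Mat (d : ℕ) := Matrix (Fin d) (Fin d) ℝ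

/-- Spectral (operator 2-) norm of a real matrix. -/
def spec {d : ℕ} (A : Mat d) : ℝ := ‖Matrix.toEuclideanCLM (𝕜 := ℝ) A‖

/-- Frobenius norm of a real matrix. -/
def frob {d : ℕ} (A : Mat d) : ℝ := Real.sqrt (∑ i, ∑ j, (A i j) ^ 2)

/-- A matrix acting on a Euclidean vector. -/
def mApp {d : ℕ} (A : Mat d) (v : E d) : E d := Matrix.toEuclideanCLM (𝕜 := ℝ) A v

/-- Outer product `u vᵀ`. -/
def outer {d : ℕ} (u v : E d) : Mat d := Matrix.of fun i j => u i * v j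

/-- Euclidean dot product. -/
def dot {d : ℕ} (u v : E d) : ℝ := ∑ i, u i * v i

/-- `σ(x) = (M/μ^{3/2})·‖H_*^{1/2}(x − x_*)‖`. -/
def sig {d : ℕ} (M μ : ℝ) (sqH : Mat d) (xs x : E d) : ℝ :=
  M / μ ^ ((3:ℝ)/2) * ‖mApp sqH (x - xs)‖

lemma mApp_mul {d : ℕ} (A B : Mat d) (v : E d) : mApp (A * B) v = mApp A (mApp B v) := by
  simp [mApp]

lemma mApp_one {d : ℕ} (v : E d) : mApp 1 v = v := by
  simp [mApp]

lemma mApp_add_vec {d : ℕ} (A : Mat d) (u v : E d) : mApp A (u + v) = mApp A u + mApp A v :=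
  map_add _ _ _

lemma mApp_sub_vec {d : ℕ} (A : Mat d) (u v : E d) : mApp A (u - v) = mApp A u - mApp A v :=
  map_sub _ _ _

lemma mApp_sub {d : ℕ} (A B : Mat d) (v : E d) : mApp (A - B) v = mApp A v - mApp B v := by
  simp [mApp]

lemma norm_mApp_le {d : ℕ} (A : Mat d) (v : E d) : ‖mApp A v‖ ≤ spec A * ‖v‖ :=
  ContinuousLinearMap.le_opNorm _ _

lemma dot_eq_inner {d : ℕ} (u v : E d) : dot u v = inner ℝ u v := by
  simp [dot, PiLp.inner_apply, mul_comm]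

lemma dot_mApp_mul_self {d : ℕ} {A : Mat d} (hA : A.IsHermitian) (v : E d) :
    dot v (mApp (A * A) v) = ‖mApp A v‖ ^ 2 := by
  have h : Matrix.toEuclideanCLM (𝕜 := ℝ) A =
      ContinuousLinearMap.adjoint (Matrix.toEuclideanCLM (𝕜 := ℝ) A) := by
    rw [← ContinuousLinearMap.star_eq_adjoint, ← map_star, Matrix.star_eq_conjTranspose, hA.eq]
  rw [dot_eq_inner, mApp_mul, ← real_inner_self_eq_norm_sq]
  conv_lhs => rw [mApp, h]
  exact ContinuousLinearMap.adjoint_inner_right _ _ _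

lemma hasGradientAt_eq_zero_of_forall_le {d : ℕ} {f : E d → ℝ} {x v : E d}
    (hf : HasGradientAt f v x) (hmin : ∀ y, f x ≤ f y) : v = 0 := by
  have h := (IsLocalMin.hasFDerivAt_eq_zero (Filter.Eventually.of_forall hmin) hf.hasFDerivAt)
  simpa using h

lemma norm_sub_sub_mApp_le {d : ℕ} {g : E d → E d} {J : E d → Mat d} {a : E d} {M : ℝ}
    (hM : 0 ≤ M) (hJ : ∀ x, HasFDerivAt g (Matrix.toEuclideanCLM (𝕜 := ℝ) (J x)) x)
    (hLip : ∀ x, spec (J x - J a) ≤ M * ‖x - a‖) (x : E d) :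
    ‖g x - g a - mApp (J a) (x - a)‖ ≤ M * ‖x - a‖ ^ 2 := by
  have h := (convex_closedBall a ‖x - a‖).norm_image_sub_le_of_norm_hasFDerivWithin_le'
    (f := g) (φ := Matrix.toEuclideanCLM (𝕜 := ℝ) (J a)) (C := M * ‖x - a‖) (x := a) (y := x)
    (fun y _ => (hJ y).hasFDerivWithinAt)
    (fun y hy => by
      rw [← map_sub]
      refine (hLip y).trans (mul_le_mul_of_nonneg_left ?_ hM)
      simpa [dist_eq_norm] using hy)
    (by simp) (by simp [dist_eq_norm])
  simpa [mApp, pow_two, mul_assoc] using h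

/-- The error of a quasi-Newton step `e - B⁻¹ (S² e + r)`, measured after applying `S`. -/
lemma mApp_sub_mApp_inv {d : ℕ} {S B : Mat d} (hS : IsUnit S) (hB : IsUnit (S⁻¹ * B * S⁻¹))
    (e r : E d) :
    mApp S (e - mApp B⁻¹ (mApp (S * S) e + r)) =
      mApp (S⁻¹ * B * S⁻¹)⁻¹ (mApp (S⁻¹ * B * S⁻¹ - 1) (mApp S e) - mApp S⁻¹ r) := by
  have hSd := (Matrix.isUnit_iff_isUnit_det S).1 hS
  have hBd := (Matrix.isUnit_iff_isUnit_det _).1 hB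
  have hinv : (S⁻¹ * B * S⁻¹)⁻¹ = S * B⁻¹ * S := by
    simp [Matrix.mul_inv_rev, Matrix.nonsing_inv_nonsing_inv _ hSd, mul_assoc]
  have h₁ : (S⁻¹ * B * S⁻¹)⁻¹ * (S⁻¹ * B * S⁻¹ - 1) * S = S - S * B⁻¹ * (S * S) := by
    rw [mul_sub, Matrix.nonsing_inv_mul _ hBd, hinv]
    noncomm_ring
  have h₂ : (S⁻¹ * B * S⁻¹)⁻¹ * S⁻¹ = S * B⁻¹ := by
    rw [hinv, mul_assoc, Matrix.mul_nonsing_inv _ hSd, mul_one]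
  rw [mApp_sub_vec (S⁻¹ * B * S⁻¹)⁻¹, ← mApp_mul, ← mApp_mul, ← mApp_mul, h₁, h₂]
  simp only [mApp_sub_vec, mApp_add_vec, mApp_sub, mApp_mul]
  abel

theorem newton_like_step_contraction_B
    {d : ℕ}
    (f : E d → ℝ) (g : E d → E d) (Hess : E d → Mat d) (xs : E d)
    (μ L M : ℝ) (hμ : 0 < μ) (hμL : μ ≤ L) (hM : 0 < M)
    -- `g` is the gradient of `f`, and `Hess` its Hessian (so `f` is twice differentiable)
    (hg : ∀ x, HasGradientAt f (g x) x)
    (hHd : ∀ x, HasFDerivAt g (Matrix.toEuclideanCLM (𝕜 := ℝ) (Hess x)) x)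
    -- `xs` is the unique minimizer of `f`
    (hmin : ∀ x, f xs ≤ f x)
    (huniq : ∀ x, (∀ y, f x ≤ f y) → x = xs)
    -- Assumption 1: strong convexity and gradient Lipschitz continuity
    (hgl : ∀ x y, μ * ‖x - y‖ ≤ ‖g x - g y‖)
    (hgu : ∀ x y, ‖g x - g y‖ ≤ L * ‖x - y‖)
    (hHl : ∀ x v, μ * ‖v‖ ^ 2 ≤ dot v (mApp (Hess x) v))
    (hHu : ∀ x v, dot v (mApp (Hess x) v) ≤ L * ‖v‖ ^ 2)
    -- Assumption 2: Hessian Lipschitz continuity toward the optimum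
    (hLip : ∀ x, spec (Hess x - Hess xs) ≤ M * ‖x - xs‖)
    -- `sqH` is the positive definite square root `H_*^{1/2}` of `H_* = ∇²f(x_*)`
    (sqH : Mat d) (hsqH : sqH.PosDef) (hsqH2 : sqH * sqH = Hess xs)
    (Bm : Mat d) (hBm : Bm.IsSymm)
    (hBhat : IsUnit (sqH⁻¹ * Bm * sqH⁻¹))
    (x : E d) :
    sig M μ sqH xs (x - mApp Bm⁻¹ (g x)) ≤
      spec (sqH⁻¹ * Bm * sqH⁻¹)⁻¹ *
        (sig M μ sqH xs x + spec (sqH⁻¹ * Bm * sqH⁻¹ - 1)) * sig M μ sqH xs x := by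
  have hS : IsUnit sqH := hsqH.isUnit
  have hSd := (Matrix.isUnit_iff_isUnit_det sqH).1 hS
  have hlow (v : E d) : √μ * ‖v‖ ≤ ‖mApp sqH v‖ := by
    refine le_of_sq_le_sq ?_ (norm_nonneg _)
    rw [mul_pow, Real.sq_sqrt hμ.le, ← dot_mApp_mul_self hsqH.isHermitian, hsqH2]
    exact hHl xs v
  set e := x - xs with he
  set r := g x - mApp (Hess xs) e with hr
  have hgxs : g xs = 0 := hasGradientAt_eq_zero_of_forall_le (hg xs) hmin
  have hrle : ‖r‖ ≤ M * ‖e‖ ^ 2 := by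
    simpa [hgxs, hr, he] using norm_sub_sub_mApp_le hM.le hHd hLip x
  have hs : 0 < √μ := Real.sqrt_pos.2 hμ
  have hpow : μ ^ ((3 : ℝ) / 2) = √μ ^ 3 := by
    rw [Real.sqrt_eq_rpow, ← Real.rpow_natCast, ← Real.rpow_mul hμ.le]
    norm_num
  have hQr : √μ * ‖mApp sqH⁻¹ r‖ ≤ ‖r‖ := by
    simpa [← mApp_mul, Matrix.mul_nonsing_inv _ hSd, mApp_one] using hlow (mApp sqH⁻¹ r)
  have hrem : ‖mApp sqH⁻¹ r‖ ≤ M / √μ ^ 3 * ‖mApp sqH e‖ * ‖mApp sqH e‖ := by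
    have h := pow_le_pow_left₀ (by positivity) (hlow e) 2
    rw [mul_assoc, div_mul_eq_mul_div, le_div_iff₀ (by positivity)]
    calc ‖mApp sqH⁻¹ r‖ * √μ ^ 3 = √μ ^ 2 * (√μ * ‖mApp sqH⁻¹ r‖) := by ring
      _ ≤ √μ ^ 2 * (M * ‖e‖ ^ 2) := mul_le_mul_of_nonneg_left (hQr.trans hrle) (by positivity)
      _ = M * (√μ * ‖e‖) ^ 2 := by ring
      _ ≤ M * (‖mApp sqH e‖ * ‖mApp sqH e‖) := by rw [← pow_two]; gcongr
  have hstep : x - mApp Bm⁻¹ (g x) - xs = e - mApp Bm⁻¹ (mApp (sqH * sqH) e + r) := by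
    rw [hsqH2, hr, add_sub_cancel, he]
    abel
  simp only [sig, hpow]
  rw [hstep, mApp_sub_mApp_inv hS hBhat, ← he]
  set T := sqH⁻¹ * Bm * sqH⁻¹
  set c := M / √μ ^ 3
  have hspec : 0 ≤ spec T⁻¹ := norm_nonneg _
  have hc : 0 ≤ c := by positivity
  calc c * ‖mApp T⁻¹ (mApp (T - 1) (mApp sqH e) - mApp sqH⁻¹ r)‖
      ≤ c * (spec T⁻¹ * (spec (T - 1) * ‖mApp sqH e‖ + c * ‖mApp sqH e‖ * ‖mApp sqH e‖)) := by
        gcongr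
        refine (norm_mApp_le _ _).trans ?_
        gcongr
        exact (norm_sub_le _ _).trans (add_le_add (norm_mApp_le _ _) hrem)
    _ = spec T⁻¹ * (c * ‖mApp sqH e‖ + spec (T - 1)) * (c * ‖mApp sqH e‖) := by ring
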